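/- Let k ≥ 2 be an integer and let 0 < c < c_{k−1} where c_{k−1} = (k−1)·log(k−1). Then for every k×k doubly stochastic matrix A, g_c(A) ≤ g_c(J_k) − ((c_{k−1} − c)/(2(k−1)²))·(ρ_A − 1), where ρ_A = Σ_{i,j} a_ij², g_c(A) = −(1/k)·Σ_{i,j} a_ij·log a_ij + c·log( 1 − 2/k + ρ_A/k² ), and J_k is the k×k matrix all of whose entries equal 1/k. -/

import Mathlib

open Finset

/-- `g_c(A) = 𝓗(A) + c 𝓔(A)`, where `𝓗(A) = -(1/k) ∑ a_ij log a_ij` (with `0 log 0 = 0`)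
and `𝓔(A) = log (1 - 2/k + (1/k²) ∑ a_ij²)`. -/
noncomputable def gFun (k : ℕ) (c : ℝ) (A : Matrix (Fin k) (Fin k) ℝ) : ℝ :=
  -(1 / (k : ℝ)) * ∑ i, ∑ j, A i j * Real.log (A i j) +
    c * Real.log (1 - 2 / (k : ℝ) + (1 / (k : ℝ) ^ 2) * ∑ i, ∑ j, (A i j) ^ 2)

/-- The constant `1/k` matrix `J_k`. -/
noncomputable def Jmat (k : ℕ) : Matrix (Fin k) (Fin k) ℝ :=
  Matrix.of fun _ _ => 1 / (k : ℝ)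

lemma Real.antitoneOn_mul_log_sub_sq :
    AntitoneOn (fun r : ℝ => r * Real.log r - (r ^ 2 - 1) / 2) (Set.Ioi 0) := by
  have hd : ∀ x ∈ Set.Ioi (0 : ℝ),
      HasDerivAt (fun r : ℝ => r * Real.log r - (r ^ 2 - 1) / 2) (Real.log x + 1 - x) x := by
    intro x hx
    have h := (Real.hasDerivAt_mul_log (ne_of_gt hx)).sub
      (((hasDerivAt_pow 2 x).sub_const 1).div_const 2)
    refine h.congr_deriv ?_
    norm_num
  refine antitoneOn_of_deriv_nonpos (convex_Ioi 0)
    (fun x hx => (hd x hx).continuousAt.continuousWithinAt) ?_ ?_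
  · intro x hx
    rw [interior_Ioi] at hx
    exact (hd x hx).differentiableAt.differentiableWithinAt
  · intro x hx
    rw [interior_Ioi] at hx
    rw [(hd x hx).deriv]
    linarith [Real.log_le_sub_one_of_pos hx]

lemma Real.mul_log_le_sq_sub_one_div_two {r : ℝ} (hr : 1 ≤ r) :
    r * Real.log r ≤ (r ^ 2 - 1) / 2 := by
  have h := Real.antitoneOn_mul_log_sub_sq (Set.mem_Ioi.2 one_pos)
    (Set.mem_Ioi.2 (one_pos.trans_le hr)) hr
  norm_num at h
  linarith

lemma Real.sq_sub_one_div_two_le_mul_log {r : ℝ} (h0 : 0 < r) (hr : r ≤ 1) :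
    (r ^ 2 - 1) / 2 ≤ r * Real.log r := by
  have h := Real.antitoneOn_mul_log_sub_sq (Set.mem_Ioi.2 h0) (Set.mem_Ioi.2 one_pos) hr
  norm_num at h
  linarith

lemma Real.two_mul_sub_one_le_add_one_mul_log {r : ℝ} (hr : 1 ≤ r) :
    2 * (r - 1) ≤ (r + 1) * Real.log r := by
  have h := Real.le_log_one_add_of_nonneg (sub_nonneg.2 hr)
  rw [show 1 + (r - 1) = r by ring, show r - 1 + 2 = r + 1 by ring,
    div_le_iff₀ (by linarith)] at h
  linarith

lemma Real.antitoneOn_mul_log_div_sq :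
    AntitoneOn (fun r : ℝ => (r * Real.log r - r + 1) / (r - 1) ^ 2) (Set.Ioi 1) := by
  have hd : ∀ x ∈ Set.Ioi (1 : ℝ),
      HasDerivAt (fun r : ℝ => (r * Real.log r - r + 1) / (r - 1) ^ 2)
        ((2 * (x - 1) - (x + 1) * Real.log x) / (x - 1) ^ 3) x := by
    intro x hx
    have hx1 : x - 1 ≠ 0 := sub_ne_zero.2 (ne_of_gt hx)
    have h := (((Real.hasDerivAt_mul_log (ne_of_gt (one_pos.trans hx))).sub
      (hasDerivAt_id x)).add_const 1).div (((hasDerivAt_id x).sub_const 1).pow 2)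
      (pow_ne_zero 2 hx1)
    refine h.congr_deriv ?_
    simp only [id, Pi.sub_apply, Pi.pow_apply]
    field_simp
    ring
  refine antitoneOn_of_deriv_nonpos (convex_Ioi 1)
    (fun x hx => (hd x hx).continuousAt.continuousWithinAt) ?_ ?_
  · intro x hx
    rw [interior_Ioi] at hx
    exact (hd x hx).differentiableAt.differentiableWithinAt
  · intro x hx
    rw [interior_Ioi] at hx
    rw [(hd x hx).deriv]
    refine div_nonpos_of_nonpos_of_nonneg ?_ (pow_nonneg (sub_nonneg.2 (le_of_lt hx)) 3)
    linarith [Real.two_mul_sub_one_le_add_one_mul_log (le_of_lt hx)]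

lemma Real.mul_sq_le_mul_log_of_le {K b r : ℝ} (hb : 1 < b)
    (hK : K * (b - 1) ^ 2 ≤ b * Real.log b - b + 1) (h0 : 0 ≤ r) (hr : r ≤ b) :
    K * (r - 1) ^ 2 ≤ r * Real.log r - r + 1 := by
  have hb' : 0 < (b - 1) ^ 2 := pow_pos (sub_pos.2 hb) 2
  rcases lt_or_ge 1 r with h1 | h1
  · have h := Real.antitoneOn_mul_log_div_sq (Set.mem_Ioi.2 h1) (Set.mem_Ioi.2 hb) hr
    have hr' : 0 < (r - 1) ^ 2 := pow_pos (sub_pos.2 h1) 2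
    rw [← le_div_iff₀ hb'] at hK
    rw [← le_div_iff₀ hr']
    exact hK.trans h
  · have hK2 : K ≤ 1 / 2 := by
      have := Real.mul_log_le_sq_sub_one_div_two hb.le
      by_contra! hc
      nlinarith
    have h2 : (r - 1) ^ 2 / 2 ≤ r * Real.log r - r + 1 := by
      rcases h0.eq_or_lt with rfl | h0
      · norm_num
      · linarith [Real.sq_sub_one_div_two_le_mul_log h0 h1]
    nlinarith [sq_nonneg (r - 1)]

lemma Real.mul_log_add_sub_le_mul_log {x y : ℝ} (hx : 0 ≤ x) (hy : 0 < y) :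
    x * Real.log y + x - y ≤ x * Real.log x := by
  rcases hx.eq_or_lt with rfl | hx
  · simpa using hy.le
  · have h := Real.log_le_sub_one_of_pos (div_pos hy hx)
    rw [Real.log_div hy.ne' hx.ne'] at h
    have := mul_le_mul_of_nonneg_left h hx.le
    rw [mul_sub, mul_sub, mul_div_cancel₀ _ hx.ne'] at this
    linarith

/-- Quadratic refinement of Jensen's inequality for `x log x` with mean `m`. -/
lemma Finset.sum_mul_log_ge_of_le {ι : Type*} (s : Finset ι) (p : ι → ℝ) {m b K : ℝ}
    (hm : 0 < m) (hb : 1 < b) (hK : K * (b - 1) ^ 2 ≤ b * Real.log b - b + 1)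
    (hp : ∀ i ∈ s, 0 ≤ p i) (hpb : ∀ i ∈ s, p i ≤ b * m) (hsum : ∑ i ∈ s, p i = #s * m) :
    #s * m * Real.log m + K / m * (∑ i ∈ s, p i ^ 2 - #s * m ^ 2) ≤
      ∑ i ∈ s, p i * Real.log (p i) := by
  have key : ∀ i ∈ s, p i * Real.log m + (p i - m) + K / m * (p i ^ 2 - 2 * m * p i + m ^ 2) ≤
      p i * Real.log (p i) := by
    intro i hi
    have h := Real.mul_sq_le_mul_log_of_le (r := p i / m) hb hK (div_nonneg (hp i hi) hm.le)
      ((div_le_iff₀ hm).2 (hpb i hi))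
    rcases (hp i hi).eq_or_lt with h0 | h0
    · rw [← h0] at h ⊢
      have hK1 : K ≤ 1 := by simpa using h
      have e : K / m * m ^ 2 = K * m := by
        field_simp
      norm_num
      nlinarith
    · rw [Real.log_div h0.ne' hm.ne'] at h
      have := mul_le_mul_of_nonneg_right h hm.le
      have e1 : K * (p i / m - 1) ^ 2 * m = K / m * (p i ^ 2 - 2 * m * p i + m ^ 2) := by
        field_simp
        ring
      have e2 : (p i / m * (Real.log (p i) - Real.log m) - p i / m + 1) * m =
          p i * Real.log (p i) - p i * Real.log m - (p i - m) := by
        field_simp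
        ring
      linarith
  refine le_trans (le_of_eq ?_) (Finset.sum_le_sum key)
  rw [Finset.sum_add_distrib, Finset.sum_add_distrib, ← Finset.sum_mul, Finset.sum_sub_distrib,
    ← Finset.mul_sum, Finset.sum_add_distrib, Finset.sum_sub_distrib, ← Finset.mul_sum, hsum]
  simp only [Finset.sum_const, nsmul_eq_mul]
  ring

lemma Real.log_seven_gt : (1.9457 : ℝ) < Real.log 7 := by
  have h := Real.one_sub_inv_le_log_of_pos (show (0 : ℝ) < 49 / 48 by norm_num)
  rw [show (49 / 48 : ℝ) = 7 ^ 2 / (2 ^ 4 * 3) by norm_num,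
    Real.log_div (by norm_num) (by norm_num), Real.log_mul (by norm_num) (by norm_num),
    Real.log_pow, Real.log_pow] at h
  norm_num at h
  linarith [Real.log_two_gt_d9, Real.log_three_gt_d9]

lemma Real.log_seven_lt : Real.log 7 < (1.9461 : ℝ) := by
  have h := Real.log_le_sub_one_of_pos (show (0 : ℝ) < 49 / 50 by norm_num)
  rw [show (49 / 50 : ℝ) = 7 ^ 2 / (2 * 5 ^ 2) by norm_num,
    Real.log_div (by norm_num) (by norm_num), Real.log_mul (by norm_num) (by norm_num),
    Real.log_pow, Real.log_pow] at h
  norm_num at h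
  linarith [Real.log_two_lt_d9, Real.log_five_lt_d9]

lemma Real.log_six_eq : Real.log 6 = Real.log 2 + Real.log 3 := by
  rw [show (6 : ℝ) = 2 * 3 by norm_num, Real.log_mul (by norm_num) (by norm_num)]

lemma Real.log_eight_eq : Real.log 8 = 3 * Real.log 2 := by
  rw [show (8 : ℝ) = 2 ^ 3 by norm_num, Real.log_pow]; norm_num

lemma Real.log_nine_eq : Real.log 9 = 2 * Real.log 3 := by
  rw [show (9 : ℝ) = 3 ^ 2 by norm_num, Real.log_pow]; norm_num

/-- Tangent line bound for `log` in the variable `1 / x`. -/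
lemma Real.log_add_one_sub_div_le_log {c x : ℝ} (hc : 0 < c) (hx : 0 < x) :
    Real.log c + 1 - c / x ≤ Real.log x := by
  have h := Real.log_le_sub_one_of_pos (div_pos hc hx)
  rw [Real.log_div hc.ne' hx.ne'] at h
  linarith

/-- The entropy bound at the coordinate value `1 / 2`, relative to the mean `1 / (n + 1)`. -/
lemma log_div_mul_sq_half_le {n : ℕ} (hn : 2 ≤ n) :
    Real.log n / n * (((n : ℝ) + 1) / 2 - 1) ^ 2 ≤
      ((n : ℝ) + 1) / 2 * Real.log (((n : ℝ) + 1) / 2) - ((n : ℝ) + 1) / 2 + 1 := by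
  have h2 := Real.log_two_gt_d9
  have h2' := Real.log_two_lt_d9
  have h3 := Real.log_three_gt_d9
  have h3' := Real.log_three_lt_d9
  have h5 := Real.log_five_gt_d9
  have h5' := Real.log_five_lt_d9
  have h7 := Real.log_seven_gt
  have h7' := Real.log_seven_lt
  rw [Real.log_div (by positivity) (by norm_num)]
  rcases lt_or_ge n 9 with h | h
  · interval_cases n <;> norm_num [Real.log_four_eq, Real.log_six_eq, Real.log_eight_eq,
      Real.log_nine_eq] <;> linarith
  · have hx : (9 : ℝ) ≤ n := by exact_mod_cast h
    generalize (n : ℝ) = x at hx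
    have hl : Real.log x ≤ Real.log (x + 1) - 1 / (x + 1) := by
      have := Real.log_le_sub_one_of_pos (show 0 < x / (x + 1) by positivity)
      rw [Real.log_div (by positivity) (by positivity)] at this
      have e : x / (x + 1) - 1 = - (1 / (x + 1)) := by field_simp; ring
      linarith
    have hL := Real.log_add_one_sub_div_le_log (c := 12) (x := x + 1) (by norm_num) (by linarith)
    have h12 : Real.log 12 = 2 * Real.log 2 + Real.log 3 := by
      rw [show (12 : ℝ) = 4 * 3 by norm_num, Real.log_mul (by norm_num) (by norm_num),
        Real.log_four_eq]
    have hL' : 3.4849 - 12 / (x + 1) ≤ Real.log (x + 1) := by linarith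
    generalize Real.log (x + 1) = L at *
    have hx0 : 0 < x := by linarith
    have hx1 : 0 < x + 1 := by linarith
    have s1 : Real.log x / x * ((x + 1) / 2 - 1) ^ 2 ≤
        (L - 1 / (x + 1)) / x * ((x + 1) / 2 - 1) ^ 2 := by gcongr
    refine s1.trans ?_
    have s2 : (L - 1 / (x + 1)) / x * ((x + 1) / 2 - 1) ^ 2 =
        ((x - 1) ^ 2 / (4 * x)) * L - (x - 1) ^ 2 / (4 * x * (x + 1)) := by
      field_simp
      ring
    rw [s2]
    have s3 : ((x + 1) / 2 - (x - 1) ^ 2 / (4 * x)) * (3.4849 - 12 / (x + 1)) ≤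
        ((x + 1) / 2 - (x - 1) ^ 2 / (4 * x)) * L := by
      refine mul_le_mul_of_nonneg_left hL' ?_
      rw [sub_nonneg, div_le_div_iff₀ (by positivity) (by norm_num)]
      nlinarith
    have s4 : (x + 1) / 2 * 0.6932 + (x + 1) / 2 - 1 - (x - 1) ^ 2 / (4 * x * (x + 1)) ≤
        ((x + 1) / 2 - (x - 1) ^ 2 / (4 * x)) * (3.4849 - 12 / (x + 1)) := by
      rw [← sub_nonneg]
      have e : ((x + 1) / 2 - (x - 1) ^ 2 / (4 * x)) * (3.4849 - 12 / (x + 1)) -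
          ((x + 1) / 2 * 0.6932 + (x + 1) / 2 - 1 - (x - 1) ^ 2 / (4 * x * (x + 1))) =
          ((x ^ 2 + 4 * x - 1) * (3.4849 * (x + 1) - 12) - 2 * x * (x + 1) ^ 2 * 1.6932 +
            4 * x * (x + 1) + (x - 1) ^ 2) / (4 * x * (x + 1)) := by
        field_simp
        ring
      rw [e]
      refine div_nonneg ?_ (by positivity)
      obtain ⟨t, rfl⟩ : ∃ t, x = t + 9 := ⟨x - 9, by ring⟩
      have ht : 0 ≤ t := by linarith
      ring_nf
      positivity
    nlinarith

lemma quadratic_nonneg_of_endpoints {α β γ u v x : ℝ} (hγ : 0 ≤ γ) (hu : u ≤ x) (hv : x ≤ v)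
    (h1 : 0 ≤ α + β * u - γ * u ^ 2) (h2 : 0 ≤ α + β * v - γ * v ^ 2) :
    0 ≤ α + β * x - γ * x ^ 2 := by
  rcases (hu.trans hv).eq_or_lt with h | h
  · obtain rfl : x = u := le_antisymm (h ▸ hv) hu
    exact h1
  · have e : (v - u) * (α + β * x - γ * x ^ 2) = (v - x) * (α + β * u - γ * u ^ 2) +
        (x - u) * (α + β * v - γ * v ^ 2) + γ * ((x - u) * (v - x) * (v - u)) := by ring
    refine nonneg_of_mul_nonneg_right (a := v - u) ?_ (sub_pos.2 h)
    rw [e]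
    have := sub_nonneg.2 hu
    have := sub_nonneg.2 hv
    have := (sub_pos.2 h).le
    positivity

/-- Gibbs' inequality for a two-point distribution. -/
lemma Real.two_point_gibbs {x y : ℝ} (hx0 : 0 ≤ x) (hx1 : x ≤ 1) (hy0 : 0 < y) (hy1 : y < 1) :
    x * Real.log y + (1 - x) * Real.log (1 - y) ≤
      x * Real.log x + (1 - x) * Real.log (1 - x) := by
  have h1 := Real.mul_log_add_sub_le_mul_log hx0 hy0
  have h2 := Real.mul_log_add_sub_le_mul_log (sub_nonneg.2 hx1) (sub_pos.2 hy1)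
  linarith

lemma concaveOn_log_add_div_add_mul {κ : ℝ} (hκ : 0 < κ) (α β : ℝ) :
    ConcaveOn ℝ (Set.Ici (2 * κ)) (fun x => Real.log x + κ / x + α + β * x) := by
  have hpos : ∀ x ∈ Set.Ici (2 * κ), 0 < x := fun x hx =>
    lt_of_lt_of_le (by linarith) (Set.mem_Ici.1 hx)
  have hd : ∀ x ∈ Set.Ici (2 * κ),
      HasDerivAt (fun x => Real.log x + κ / x + α + β * x) (x⁻¹ - κ / x ^ 2 + β) x := by
    intro x hx
    have hx0 := (hpos x hx).ne'
    have h := (((Real.hasDerivAt_log hx0).add ((hasDerivAt_inv hx0).const_mul κ)).add_const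
      α).add ((hasDerivAt_id x).const_mul β)
    refine (h.congr_deriv ?_).congr_of_eventuallyEq (Filter.Eventually.of_forall fun y => ?_)
    · ring
    · simp [div_eq_mul_inv]
  refine AntitoneOn.concaveOn_of_deriv (convex_Ici _)
    (fun x hx => (hd x hx).continuousAt.continuousWithinAt)
    (fun x hx => (hd x (interior_subset hx)).differentiableAt.differentiableWithinAt) ?_
  intro x hx y hy hxy
  have hx := interior_subset hx
  have hy := interior_subset hy
  rw [(hd x hx).deriv, (hd y hy).deriv]
  have hx0 := hpos x hx
  have hy0 := hpos y hy
  have e : (x⁻¹ - κ / x ^ 2 + β) - (y⁻¹ - κ / y ^ 2 + β) =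
      (y - x) * (x * y - κ * (x + y)) / (x ^ 2 * y ^ 2) := by
    field_simp
    ring
  rw [← sub_nonneg, e]
  rw [Set.mem_Ici] at hx hy
  have : 0 ≤ x * y - κ * (x + y) := by nlinarith
  have := sub_nonneg.2 hxy
  positivity

/-- For the distribution with one atom `1 - x` and the remaining mass spread evenly over `n`
points, this is relative entropy minus the quadratic lower bound. -/
noncomputable def entropyGap (n x : ℝ) : ℝ :=
  Real.log (n + 1) - Real.log n + (x * Real.log x + (1 - x) * Real.log (1 - x)) +
    Real.log n * (1 + 2 / n) * x - Real.log n * (1 + 1 / n) ^ 2 * x ^ 2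

/-- Nonnegativity on an interval, from the tangent line of the binary entropy at `y`. -/
lemma entropyGap_nonneg_of_tangent {n u v x : ℝ} (y : ℝ) (hn : 1 ≤ n) (hx0 : 0 ≤ x) (hx1 : x ≤ 1)
    (hy0 : 0 < y) (hy1 : y < 1) (hu : u ≤ x) (hv : x ≤ v)
    (h1 : 0 ≤ (Real.log (n + 1) - Real.log n + Real.log (1 - y)) +
      (Real.log y - Real.log (1 - y) + Real.log n * (1 + 2 / n)) * u -
      Real.log n * (1 + 1 / n) ^ 2 * u ^ 2)
    (h2 : 0 ≤ (Real.log (n + 1) - Real.log n + Real.log (1 - y)) +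
      (Real.log y - Real.log (1 - y) + Real.log n * (1 + 2 / n)) * v -
      Real.log n * (1 + 1 / n) ^ 2 * v ^ 2) :
    0 ≤ entropyGap n x := by
  have hL := Real.log_nonneg hn
  have h := quadratic_nonneg_of_endpoints (by positivity) hu hv h1 h2
  have := Real.two_point_gibbs hx0 hx1 hy0 hy1
  unfold entropyGap
  linarith

lemma entropyGap_nonneg_of_le {n x : ℝ} (hn : 1 ≤ n) (hx0 : 0 ≤ x) (hx1 : x ≤ 1)
    (hx : x ≤ 2 * n / (n + 1) ^ 2) : 0 ≤ entropyGap n x := by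
  have hn0 : 0 < n := by linarith
  have e1 : 1 - 1 / (n + 1) = n / (n + 1) := by field_simp; ring
  refine entropyGap_nonneg_of_tangent (u := 0) (1 / (n + 1)) hn hx0 hx1 (by positivity)
    ((div_lt_one (by positivity)).2 (by linarith)) hx0 hx ?_ ?_
  · rw [e1, Real.log_div (by positivity) (by positivity)]
    ring_nf
    rfl
  · rw [e1, Real.log_div (by positivity) (by positivity),
      Real.log_div (by positivity) (by positivity), Real.log_one]
    refine le_of_eq ?_
    field_simp
    ring

/-- For large `n`, a concave minorant of `entropyGap n x / x` is nonnegative at both ends of the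
remaining interval. -/
lemma entropyGap_nonneg_of_seven_le {n x : ℝ} (hn : 7 ≤ n) (hx : 2 * n / (n + 1) ^ 2 ≤ x)
    (hx2 : x ≤ 1 / 2) : 0 ≤ entropyGap n x := by
  have hn0 : 0 < n := by linarith
  have hx0 : 0 < x := lt_of_lt_of_le (by positivity) hx
  set κ : ℝ := n / (n + 1) ^ 2 with hκ
  have hκ0 : 0 < κ := by positivity
  have hκx : 2 * κ ≤ x := by rw [hκ]; linarith [mul_div_assoc 2 n ((n + 1) ^ 2)]
  have hκn : 0.765 / n ≤ κ := by
    rw [hκ, div_le_div_iff₀ hn0 (by positivity)]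
    nlinarith
  have hlow : 1 / (n + 1) ≤ Real.log (n + 1) - Real.log n := by
    have := Real.log_le_sub_one_of_pos (show 0 < n / (n + 1) by positivity)
    rw [Real.log_div (by positivity) (by positivity)] at this
    have e : n / (n + 1) - 1 = - (1 / (n + 1)) := by field_simp; ring
    linarith
  have hup : Real.log (n + 1) - Real.log n ≤ 1 / n := by
    have := Real.log_le_sub_one_of_pos (show 0 < (n + 1) / n by positivity)
    rw [Real.log_div (by positivity) (by positivity)] at this
    have e : (n + 1) / n - 1 = 1 / n := by field_simp; ring
    linarith
  have hκ1 : κ ≤ 1 / (n + 1) := by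
    rw [hκ, div_le_div_iff₀ (by positivity) (by positivity)]
    nlinarith
  have h2 := Real.log_two_gt_d9
  have h2' := Real.log_two_lt_d9
  have hi : 1 / n ≤ 1 / 7 := by gcongr
  have hL := Real.log_add_one_sub_div_le_log (c := 7) (by norm_num) hn0
  have hL7 : Real.log 7 ≤ Real.log n := Real.log_le_log (by norm_num) hn
  have hs7 := Real.log_seven_gt
  set L := Real.log n with hLdef
  have hc := concaveOn_log_add_div_add_mul hκ0 (L * (1 + 2 / n) - 1)
    (1 / 2 - L * (1 + 1 / n) ^ 2)
  have hmin := hc.min_le_of_mem_Icc (Set.mem_Ici.2 le_rfl)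
    (Set.mem_Ici.2 (hκx.trans hx2)) (Set.mem_Icc.2 ⟨hκx, hx2⟩)
  have hleft : 0 ≤ Real.log (2 * κ) + κ / (2 * κ) + (L * (1 + 2 / n) - 1) +
      (1 / 2 - L * (1 + 1 / n) ^ 2) * (2 * κ) := by
    have e1 : κ / (2 * κ) = 1 / 2 := by field_simp
    have e2 : (1 / 2 - L * (1 + 1 / n) ^ 2) * (2 * κ) = κ - 2 * L / n := by
      rw [hκ]; field_simp
    have e3 : Real.log (2 * κ) = Real.log 2 + (L - 2 * Real.log (n + 1)) := by
      rw [Real.log_mul (by norm_num) hκ0.ne', hκ, Real.log_div hn0.ne' (by positivity),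
        Real.log_pow]
      norm_num
      rfl
    rw [e1, e2, e3]
    have e4 : L * (1 + 2 / n) = L + 2 * L / n := by ring
    have e5 : 0.765 / n = 0.765 * (1 / n) := by ring
    rw [e4]
    linarith
  have hright : 0 ≤ Real.log (1 / 2) + κ / (1 / 2) + (L * (1 + 2 / n) - 1) +
      (1 / 2 - L * (1 + 1 / n) ^ 2) * (1 / 2) := by
    rw [one_div 2, Real.log_inv]
    have e5 : 0.765 / n = 0.765 * (1 / n) := by ring
    have e6 : (7 : ℝ) / n = 7 * (1 / n) := by ring
    have e7 : (2 : ℝ) / n = 2 * (1 / n) := by ring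
    rw [e5] at hκn
    rw [e6] at hL
    rw [e7]
    have hy0 : 0 < 1 / n := by positivity
    generalize 1 / n = y at *
    have : 1.9457 * (y - y ^ 2 / 2) ≤ L * (y - y ^ 2 / 2) := by
      refine mul_le_mul_of_nonneg_right (by linarith) (by nlinarith)
    norm_num
    nlinarith
  have hG := (le_min hleft hright).trans hmin
  have hG' := mul_nonneg hx0.le hG
  have hq := Real.sq_sub_one_div_two_le_mul_log (r := 1 - x) (by linarith) (by linarith)
  have e : x * (Real.log x + κ / x + (L * (1 + 2 / n) - 1) + (1 / 2 - L * (1 + 1 / n) ^ 2) * x) =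
      x * Real.log x + κ + L * (1 + 2 / n) * x - x + x ^ 2 / 2 -
        L * (1 + 1 / n) ^ 2 * x ^ 2 := by
    field_simp
    ring
  rw [e] at hG'
  unfold entropyGap
  rw [← hLdef]
  linarith

lemma entropyGap_nonneg {n : ℕ} (hn : 2 ≤ n) {x : ℝ} (hx0 : 0 ≤ x) (hx : x ≤ 1 / 2) :
    0 ≤ entropyGap n x := by
  have hn1 : (1 : ℝ) ≤ n := by exact_mod_cast (by lia : 1 ≤ n)
  rcases le_total x (2 * (n : ℝ) / ((n : ℝ) + 1) ^ 2) with h | h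
  · exact entropyGap_nonneg_of_le hn1 hx0 (by linarith) h
  rcases lt_or_ge n 7 with h7 | h7
  · have h2 := Real.log_two_gt_d9
    have h2' := Real.log_two_lt_d9
    have h3 := Real.log_three_gt_d9
    have h3' := Real.log_three_lt_d9
    have h5 := Real.log_five_gt_d9
    have h5' := Real.log_five_lt_d9
    have h7l := Real.log_seven_gt
    have h7u := Real.log_seven_lt
    have hdiv : ∀ a b : ℝ, a ≠ 0 → b ≠ 0 → Real.log (a / b) = Real.log a - Real.log b :=
      fun a b ha hb => Real.log_div ha hb
    have hx1 : x ≤ 1 := by linarith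
    interval_cases n
    · refine entropyGap_nonneg_of_tangent (1 / 2) hn1 hx0 hx1 (by norm_num) (by norm_num) h hx
        ?_ ?_ <;> norm_num [hdiv] <;> linarith
    · refine entropyGap_nonneg_of_tangent (1 / 2) hn1 hx0 hx1 (by norm_num) (by norm_num) h hx
        ?_ ?_ <;> norm_num [Real.log_four_eq, hdiv] <;> linarith
    · refine entropyGap_nonneg_of_tangent (2 / 5) hn1 hx0 hx1 (by norm_num) (by norm_num) h hx
        ?_ ?_ <;> norm_num [Real.log_four_eq, hdiv] <;> linarith
    · refine entropyGap_nonneg_of_tangent (2 / 5) hn1 hx0 hx1 (by norm_num) (by norm_num) h hx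
        ?_ ?_ <;> norm_num [Real.log_six_eq, hdiv] <;> linarith
    · rcases le_total x (2 / 5) with h4 | h4
      · refine entropyGap_nonneg_of_tangent (3 / 10) hn1 hx0 hx1 (by norm_num) (by norm_num) h h4
          ?_ ?_ <;> norm_num [Real.log_six_eq, Real.log_ten_eq, hdiv] <;> linarith
      · refine entropyGap_nonneg_of_tangent (2 / 5) hn1 hx0 hx1 (by norm_num) (by norm_num) h4 hx
          ?_ ?_ <;> norm_num [Real.log_six_eq, hdiv] <;> linarith
  · exact entropyGap_nonneg_of_seven_le (by exact_mod_cast h7) h hx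

/-- A lower bound, quadratic in the distribution, for the relative entropy to the uniform
distribution on `n + 1` points. -/
lemma log_div_mul_sum_sq_le_relative_entropy {ι : Type*} [Fintype ι] {n : ℕ} (hn : 2 ≤ n)
    (hcard : Fintype.card ι = n + 1) (p : ι → ℝ) (hp : ∀ i, 0 ≤ p i) (hsum : ∑ i, p i = 1) :
    Real.log n / n * (((n : ℝ) + 1) * ∑ i, p i ^ 2 - 1) ≤
      Real.log ((n : ℝ) + 1) + ∑ i, p i * Real.log (p i) := by
  classical
  have hn2 : (2 : ℝ) ≤ n := by exact_mod_cast hn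
  have hn0 : (0 : ℝ) < n := by linarith
  by_cases hmax : ∀ i, p i ≤ 1 / 2
  · have hcard' : (#(univ : Finset ι) : ℝ) = n + 1 := by
      rw [Finset.card_univ, hcard]; push_cast; rfl
    have h := Finset.sum_mul_log_ge_of_le univ p (m := 1 / ((n : ℝ) + 1)) (by positivity)
      (show 1 < ((n : ℝ) + 1) / 2 by linarith) (log_div_mul_sq_half_le hn) (fun i _ => hp i)
      (fun i _ => (hmax i).trans_eq (by field_simp)) (by rw [hsum, hcard']; field_simp)
    rw [hcard', one_div, Real.log_inv, mul_inv_cancel₀ (by positivity)] at h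
    have e : Real.log n / n / ((n : ℝ) + 1)⁻¹ *
        (∑ i, p i ^ 2 - ((n : ℝ) + 1) * ((n : ℝ) + 1)⁻¹ ^ 2) =
        Real.log n / n * (((n : ℝ) + 1) * ∑ i, p i ^ 2 - 1) := by
      field_simp
    linarith
  · push Not at hmax
    obtain ⟨i₀, hi₀⟩ := hmax
    have hcard' : (#((univ : Finset ι).erase i₀) : ℝ) = n := by
      rw [Finset.card_erase_of_mem (Finset.mem_univ _), Finset.card_univ, hcard]; simp
    have split : ∀ f : ι → ℝ, ∑ i, f i = f i₀ + ∑ i ∈ univ.erase i₀, f i := fun f =>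
      (Finset.add_sum_erase _ f (Finset.mem_univ i₀)).symm
    obtain ⟨x, hx⟩ : ∃ x, p i₀ = 1 - x := ⟨1 - p i₀, by ring⟩
    have hrest : ∑ i ∈ univ.erase i₀, p i = x := by
      have := split p
      linarith
    have hle : ∀ i ∈ univ.erase i₀, p i ≤ x := fun i hi =>
      hrest ▸ Finset.single_le_sum (fun j _ => hp j) hi
    have hx0 : 0 ≤ x := hrest ▸ Finset.sum_nonneg fun j _ => hp j
    have hgap := entropyGap_nonneg hn hx0 (by linarith)
    rw [split fun i => p i ^ 2, split fun i => p i * Real.log (p i), hx]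
    unfold entropyGap at hgap
    rcases hx0.eq_or_lt with rfl | hxpos
    · have hz : ∀ i ∈ univ.erase i₀, p i = 0 := fun i hi => le_antisymm (hle i hi) (hp i)
      rw [Finset.sum_eq_zero fun i hi => by rw [hz i hi]; norm_num,
        Finset.sum_eq_zero fun i hi => by rw [hz i hi]; norm_num]
      norm_num at hgap ⊢
      rw [div_mul_cancel₀ _ hn0.ne']
      exact hgap
    · have hK : Real.log n / n * (n + 1) * (x / n) * ((n : ℝ) - 1) ^ 2 ≤
          n * Real.log n - n + 1 := by
        have hlog := Real.two_mul_sub_one_le_add_one_mul_log (r := n) (by linarith)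
        have hL := Real.log_nonneg (show (1 : ℝ) ≤ n by linarith)
        have hcoef : Real.log n / n * (n + 1) * (x / n) * ((n : ℝ) - 1) ^ 2 ≤
            Real.log n / n * (n + 1) * ((1 / 2) / n) * ((n : ℝ) - 1) ^ 2 := by
          gcongr
          linarith
        refine hcoef.trans ?_
        have e : Real.log n / n * (n + 1) * ((1 / 2) / n) * ((n : ℝ) - 1) ^ 2 =
            Real.log n * ((n + 1) * ((n : ℝ) - 1) ^ 2) / (2 * n ^ 2) := by
          field_simp
        rw [e, div_le_iff₀ (by positivity)]
        have h1 := mul_le_mul_of_nonneg_left hlog (sq_nonneg (n : ℝ))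
        have h2 : 0 ≤ Real.log n * ((n : ℝ) - 1) := mul_nonneg hL (by linarith)
        nlinarith
      have h := Finset.sum_mul_log_ge_of_le (univ.erase i₀) p (m := x / n) (by positivity)
        (show (1 : ℝ) < n by linarith) hK (fun i _ => hp i)
        (fun i hi => (hle i hi).trans_eq (by field_simp))
        (by rw [hrest, hcard']; field_simp)
      rw [hcard', Real.log_div hxpos.ne' hn0.ne', mul_div_cancel₀ _ hn0.ne'] at h
      rw [mul_div_cancel_right₀ _ (by positivity : x / (n : ℝ) ≠ 0)] at h
      generalize (∑ i ∈ univ.erase i₀, p i ^ 2) = S at *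
      generalize (∑ i ∈ univ.erase i₀, p i * Real.log (p i)) = T at *
      have e : Real.log n / n * (n + 1) * (S - n * (x / n) ^ 2) + Real.log n - x * Real.log n -
          Real.log n * (1 + 2 / n) * x + Real.log n * (1 + 1 / n) ^ 2 * x ^ 2 =
          Real.log n / n * ((n + 1) * ((1 - x) ^ 2 + S) - 1) := by
        field_simp
        ring
      linarith

/-- For `0 < c < c_{k-1} = (k-1) log (k-1)` and every doubly stochastic `A`,
`g_c(A) ≤ g_c(J_k) - ((c_{k-1} - c)/(2(k-1)²)) (ρ_A - 1)`, where `ρ_A = ∑ a_ij²`. -/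
theorem gc_exponential_decay (k : ℕ) (hk : 2 ≤ k) (c : ℝ) (hc₀ : 0 < c)
    (hc : c < ((k : ℝ) - 1) * Real.log ((k : ℝ) - 1))
    (A : Matrix (Fin k) (Fin k) ℝ)
    (hA_nonneg : ∀ i j, 0 ≤ A i j)
    (hA_row : ∀ i, ∑ j, A i j = 1)
    (hA_col : ∀ j, ∑ i, A i j = 1) :
    gFun k c A ≤ gFun k c (Jmat k) -
      (((k : ℝ) - 1) * Real.log ((k : ℝ) - 1) - c) / (2 * ((k : ℝ) - 1) ^ 2) *
        ((∑ i, ∑ j, (A i j) ^ 2) - 1) := by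
  obtain ⟨n, rfl⟩ : ∃ n, k = n + 1 := ⟨k - 1, by lia⟩
  have hn : 2 ≤ n := by
    by_contra h
    obtain rfl : n = 1 := by lia
    norm_num at hc
    linarith
  have hn2 : (2 : ℝ) ≤ n := by exact_mod_cast hn
  have hn0 : (0 : ℝ) < n := by linarith
  have hrow : ∀ i, Real.log n / n * (((n : ℝ) + 1) * ∑ j, A i j ^ 2 - 1) ≤
      Real.log ((n : ℝ) + 1) + ∑ j, A i j * Real.log (A i j) := fun i =>
    log_div_mul_sum_sq_le_relative_entropy hn (by simp) (A i) (hA_nonneg i) (hA_row i)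
  have hsum := Finset.sum_le_sum fun i (_ : i ∈ univ) => hrow i
  rw [← Finset.mul_sum, Finset.sum_sub_distrib, ← Finset.mul_sum, Finset.sum_add_distrib] at hsum
  simp only [Finset.sum_const, Finset.card_univ, Fintype.card_fin, nsmul_eq_mul] at hsum
  have hρ : 1 ≤ ∑ i, ∑ j, A i j ^ 2 := by
    have h : ∀ i, 1 / ((n : ℝ) + 1) ≤ ∑ j, A i j ^ 2 := by
      intro i
      have := sq_sum_le_card_mul_sum_sq (s := univ) (f := A i)
      rw [hA_row i, Finset.card_univ, Fintype.card_fin] at this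
      rw [div_le_iff₀ (by positivity)]
      push_cast at this
      linarith
    have := Finset.sum_le_sum fun i (_ : i ∈ univ) => h i
    simp only [Finset.sum_const, Finset.card_univ, Fintype.card_fin, nsmul_eq_mul] at this
    push_cast at this
    rwa [mul_one_div_cancel (by positivity)] at this
  unfold gFun Jmat
  simp only [Matrix.of_apply, Finset.sum_const, Finset.card_univ, Fintype.card_fin, nsmul_eq_mul]
  push_cast at hsum hc ⊢
  rw [add_sub_cancel_right] at hc ⊢
  generalize (∑ i, ∑ j, A i j ^ 2) = ρ at *
  generalize (∑ i, ∑ j, A i j * Real.log (A i j)) = T at *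
  obtain ⟨t, rfl⟩ : ∃ t, ρ = 1 + n ^ 2 * t := ⟨(ρ - 1) / n ^ 2, by field_simp; ring⟩
  have ht : 0 ≤ t := by
    by_contra! h
    nlinarith [mul_neg_of_pos_of_neg (pow_pos hn0 2) h]
  have e1 : 1 - 2 / ((n : ℝ) + 1) + 1 / ((n : ℝ) + 1) ^ 2 * (1 + n ^ 2 * t) =
      (n / (n + 1)) ^ 2 * (1 + t) := by
    field_simp
    ring
  have e2 : 1 - 2 / ((n : ℝ) + 1) + 1 / ((n : ℝ) + 1) ^ 2 *
      (((n : ℝ) + 1) * (((n : ℝ) + 1) * (1 / ((n : ℝ) + 1)) ^ 2)) = (n / (n + 1)) ^ 2 := by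
    field_simp
    ring
  have e3 : -(1 / ((n : ℝ) + 1)) * (((n : ℝ) + 1) * (((n : ℝ) + 1) *
      (1 / ((n : ℝ) + 1) * Real.log (1 / ((n : ℝ) + 1))))) = Real.log ((n : ℝ) + 1) := by
    rw [one_div, Real.log_inv]
    field_simp
  have e4 : (n * Real.log n - c) / (2 * (n : ℝ) ^ 2) * (1 + n ^ 2 * t - 1) =
      (n * Real.log n - c) * t / 2 := by
    field_simp
    ring
  rw [e1, e2, e3, e4, Real.log_mul (by positivity) (by positivity)]
  have hlog : c * Real.log (1 + t) ≤ c * t := by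
    refine mul_le_mul_of_nonneg_left ?_ hc₀.le
    linarith [Real.log_le_sub_one_of_pos (show 0 < 1 + t by linarith)]
  have hT : n * Real.log n * t - Real.log ((n : ℝ) + 1) ≤ 1 / ((n : ℝ) + 1) * T := by
    rw [one_div, inv_mul_eq_div, le_div_iff₀ (by positivity)]
    have e5 : Real.log n / n * (((n : ℝ) + 1) * (1 + n ^ 2 * t) - ((n : ℝ) + 1) * 1) =
        n * Real.log n * t * (n + 1) := by
      field_simp
      ring
    linarith
  have hnn : 0 ≤ (n * Real.log n - c) * t := mul_nonneg (by linarith) ht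
  linarith
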